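/- Fix an integer N ≥ 1 and a real number p > 1, and let d ∈ ℝ^N with |d| < 1. The boosted profile κ_d is mode stable: if λ ∈ ℂ is an eigenvalue of the linearized operator around κ_d (i.e. the eigen-equation for (d, λ) admits a solution smooth on the closed unit ball of ℝ^N and not identically zero there) and Re λ > −1, then λ = 0 or λ = 1. -/

import Mathlib

open scoped RealInnerProductSpace

noncomputable section

/-- The constant `κ₀ = (2(p+1)/(p-1)²)^{1/(p-1)}`. -/
def kappa0 (p : ℝ) : ℝ := (2 * (p + 1) / (p - 1) ^ 2) ^ (1 / (p - 1))

/-- The boosted self-similar profile `κ_d(y) = κ₀ (1-|d|²)^{1/(p-1)} (1+d⬝y)^{-2/(p-1)}`. -/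
def kd {N : ℕ} (p : ℝ) (d y : EuclideanSpace ℝ (Fin N)) : ℝ :=
  kappa0 p * (1 - ‖d‖ ^ 2) ^ (1 / (p - 1)) * (1 + ⟪d, y⟫) ^ (-(2 / (p - 1)))

/-- Partial derivative of a real-valued function in the `i`-th coordinate direction. -/
def pd {N : ℕ} (i : Fin N) (f : EuclideanSpace ℝ (Fin N) → ℝ)
    (y : EuclideanSpace ℝ (Fin N)) : ℝ :=
  fderiv ℝ f y (EuclideanSpace.single i 1)

/-- Derivative in the first (time) variable. -/
def dT {N : ℕ} (u : ℝ × EuclideanSpace ℝ (Fin N) → ℝ) (t : ℝ)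
    (x : EuclideanSpace ℝ (Fin N)) : ℝ := deriv (fun t' => u (t', x)) t

/-- Second derivative in the first (time) variable. -/
def dTT {N : ℕ} (u : ℝ × EuclideanSpace ℝ (Fin N) → ℝ) (t : ℝ)
    (x : EuclideanSpace ℝ (Fin N)) : ℝ := deriv (fun t' => dT u t' x) t

/-- Spatial Laplacian. -/
def lapX {N : ℕ} (u : ℝ × EuclideanSpace ℝ (Fin N) → ℝ) (t : ℝ)
    (x : EuclideanSpace ℝ (Fin N)) : ℝ :=
  ∑ i : Fin N, pd i (pd i (fun z => u (t, z))) x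

/-- `u` satisfies `∂ₜₜu − Δₓu = |u|^{p−1}u` at the point `q = (t, x)`. -/
def WaveEqAt {N : ℕ} (p : ℝ) (u : ℝ × EuclideanSpace ℝ (Fin N) → ℝ)
    (q : ℝ × EuclideanSpace ℝ (Fin N)) : Prop :=
  dTT u q.1 q.2 - lapX u q.1 q.2 = |u q| ^ (p - 1) * u q

/-- `U` satisfies the self-similar wave equation at `(s, y)`. -/
def SSat {N : ℕ} (p : ℝ) (U : ℝ × EuclideanSpace ℝ (Fin N) → ℝ) (s : ℝ)
    (y : EuclideanSpace ℝ (Fin N)) : Prop :=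
  dTT U s y + (p + 3) / (p - 1) * dT U s y
    + 2 * (∑ i : Fin N, y i * pd i (fun z => dT U s z) y)
    + 2 * (p + 1) / (p - 1) * (∑ i : Fin N, y i * pd i (fun z => U (s, z)) y)
    + (∑ i : Fin N, ∑ j : Fin N,
        (y i * y j - if i = j then (1 : ℝ) else 0) * pd i (pd j (fun z => U (s, z))) y)
    + 2 * (p + 1) / (p - 1) ^ 2 * U (s, y)
    = |U (s, y)| ^ (p - 1) * U (s, y)

/-- `η` satisfies the linearized self-similar equation with potential `V` at `(s, y)`. -/
def LinEqAt {N : ℕ} (p : ℝ) (V : EuclideanSpace ℝ (Fin N) → ℝ)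
    (η : ℝ × EuclideanSpace ℝ (Fin N) → ℝ) (s : ℝ)
    (y : EuclideanSpace ℝ (Fin N)) : Prop :=
  dTT η s y + (p + 3) / (p - 1) * dT η s y
    + 2 * (∑ i : Fin N, y i * pd i (fun z => dT η s z) y)
    + 2 * (p + 1) / (p - 1) * (∑ i : Fin N, y i * pd i (fun z => η (s, z)) y)
    + (∑ i : Fin N, ∑ j : Fin N,
        (y i * y j - if i = j then (1 : ℝ) else 0) * pd i (pd j (fun z => η (s, z))) y)
    + (2 * (p + 1) / (p - 1) ^ 2 - V y) * η (s, y) = 0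

/-- The Lorentz boost `Λ_β(t,x) = (γ(t − β⬝x), x − γβt + (γ²(β⬝x)/(1+γ))β)`,
with `γ = (1−|β|²)^{−1/2}`. -/
def boost {N : ℕ} (β : EuclideanSpace ℝ (Fin N)) (q : ℝ × EuclideanSpace ℝ (Fin N)) :
    ℝ × EuclideanSpace ℝ (Fin N) :=
  (((1 - ‖β‖ ^ 2) ^ (-(1 / 2) : ℝ)) * (q.1 - ⟪β, q.2⟫),
    q.2 - (((1 - ‖β‖ ^ 2) ^ (-(1 / 2) : ℝ)) * q.1) • β
      + ((((1 - ‖β‖ ^ 2) ^ (-(1 / 2) : ℝ)) ^ 2 * ⟪β, q.2⟫)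
          / (1 + (1 - ‖β‖ ^ 2) ^ (-(1 / 2) : ℝ))) • β)

/-- The spatial map `y' ↦ (y' − γβ + (γ²(β⬝y')/(1+γ))β) / (γ(1 − β⬝y'))` of the
Lorentz transform in self-similar variables. -/
def ymap {N : ℕ} (β y' : EuclideanSpace ℝ (Fin N)) : EuclideanSpace ℝ (Fin N) :=
  (((1 - ‖β‖ ^ 2) ^ (-(1 / 2) : ℝ)) * (1 - ⟪β, y'⟫))⁻¹
    • (y' - ((1 - ‖β‖ ^ 2) ^ (-(1 / 2) : ℝ)) • β
        + ((((1 - ‖β‖ ^ 2) ^ (-(1 / 2) : ℝ)) ^ 2 * ⟪β, y'⟫)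
            / (1 + (1 - ‖β‖ ^ 2) ^ (-(1 / 2) : ℝ))) • β)

/-- The Lorentz transform `𝒯_β` in self-similar variables:
`(𝒯_β U)(s',y') = (γ(1 − β⬝y'))^{−2/(p−1)} U(s' − log(1 − β⬝y'), ymap β y')`. -/
def lorentzSS {N : ℕ} (p : ℝ) (β : EuclideanSpace ℝ (Fin N))
    (U : ℝ × EuclideanSpace ℝ (Fin N) → ℝ) (q : ℝ × EuclideanSpace ℝ (Fin N)) : ℝ :=
  (((1 - ‖β‖ ^ 2) ^ (-(1 / 2) : ℝ)) * (1 - ⟪β, q.2⟫)) ^ (-(2 / (p - 1)))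
    * U (q.1 - Real.log (1 - ⟪β, q.2⟫), ymap β q.2)

/-- Partial derivative of a complex-valued function in the `i`-th coordinate direction. -/
def pdC {N : ℕ} (i : Fin N) (f : EuclideanSpace ℝ (Fin N) → ℂ)
    (y : EuclideanSpace ℝ (Fin N)) : ℂ :=
  fderiv ℝ f y (EuclideanSpace.single i 1)

/-- The eigen-equation for `(d, λ)` at a point `y`. -/
def EigenEqAt {N : ℕ} (p : ℝ) (d : EuclideanSpace ℝ (Fin N)) (lam : ℂ)
    (φ : EuclideanSpace ℝ (Fin N) → ℂ) (y : EuclideanSpace ℝ (Fin N)) : Prop :=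
  (lam ^ 2 + (((p + 3) / (p - 1) : ℝ) : ℂ) * lam + ((2 * (p + 1) / (p - 1) ^ 2 : ℝ) : ℂ)
      - ((p * kd p d y ^ (p - 1) : ℝ) : ℂ)) * φ y
    + (2 * lam + ((2 * (p + 1) / (p - 1) : ℝ) : ℂ))
        * (∑ i : Fin N, (y i : ℂ) * pdC i φ y)
    + (∑ i : Fin N, ∑ j : Fin N,
        (((y i * y j - if i = j then (1 : ℝ) else 0) : ℝ) : ℂ) * pdC i (pdC j φ) y)
    = 0

/-- `λ` is an eigenvalue of the linearized operator around `κ_d`: the eigen-equation for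
`(d, λ)` has a solution smooth on an open neighborhood of the closed unit ball that is
not identically zero on the closed unit ball. -/
def IsEigenvalue (N : ℕ) (p : ℝ) (d : EuclideanSpace ℝ (Fin N)) (lam : ℂ) : Prop :=
  ∃ φ : EuclideanSpace ℝ (Fin N) → ℂ, ∃ Ω : Set (EuclideanSpace ℝ (Fin N)),
    IsOpen Ω ∧ Metric.closedBall 0 1 ⊆ Ω ∧ ContDiffOn ℝ (⊤ : ℕ∞) φ Ω ∧
    (∀ y ∈ Metric.closedBall (0 : EuclideanSpace ℝ (Fin N)) 1, EigenEqAt p d lam φ y) ∧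
    ∃ y ∈ Metric.closedBall (0 : EuclideanSpace ℝ (Fin N)) 1, φ y ≠ 0


/-! ### Smooth calculus -/

/-- Shorthand for global smoothness. -/
def Smo {N : ℕ} (f : EuclideanSpace ℝ (Fin N) → ℂ) : Prop := ContDiff ℝ (⊤ : ℕ∞) f

lemma Smo.diff {N : ℕ} {f : EuclideanSpace ℝ (Fin N) → ℂ} (hf : Smo f) : Differentiable ℝ f :=
  ContDiff.differentiable hf (by simp)

lemma Smo.pdC {N : ℕ} {f : EuclideanSpace ℝ (Fin N) → ℂ} (hf : Smo f) (i : Fin N) :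
    Smo (pdC i f) := by
  have h : ContDiff ℝ (⊤ : ℕ∞) (fderiv ℝ f) := ContDiff.fderiv_right (m := (⊤ : ℕ∞)) hf (by simp)
  exact h.clm_apply contDiff_const

lemma Smo.add {N : ℕ} {f g : EuclideanSpace ℝ (Fin N) → ℂ} (hf : Smo f) (hg : Smo g) :
    Smo (fun y => f y + g y) := ContDiff.add hf hg

lemma Smo.mul {N : ℕ} {f g : EuclideanSpace ℝ (Fin N) → ℂ} (hf : Smo f) (hg : Smo g) :
    Smo (fun y => f y * g y) := ContDiff.mul hf hg

lemma Smo.const {N : ℕ} (c : ℂ) : Smo (fun _ : EuclideanSpace ℝ (Fin N) => c) := contDiff_const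

lemma Smo.sum {N : ℕ} {f : Fin N → EuclideanSpace ℝ (Fin N) → ℂ} (hf : ∀ i, Smo (f i)) :
    Smo (fun y => ∑ i, f i y) := ContDiff.sum (fun i _ => hf i)

lemma Smo.coord {N : ℕ} (i : Fin N) : Smo (fun y : EuclideanSpace ℝ (Fin N) => (y i : ℂ)) := by
  unfold Smo
  have h : ContDiff ℝ (⊤ : ℕ∞) (fun y : EuclideanSpace ℝ (Fin N) => y i) := by fun_prop
  exact Complex.ofRealCLM.contDiff.comp h

lemma pdC_add {N : ℕ} {f g : EuclideanSpace ℝ (Fin N) → ℂ} (hf : Smo f) (hg : Smo g) (i : Fin N)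
    (y : EuclideanSpace ℝ (Fin N)) :
    pdC i (fun y => f y + g y) y = pdC i f y + pdC i g y := by
  unfold pdC
  rw [fderiv_fun_add (hf.diff y) (hg.diff y)]; rfl

lemma pdC_mul {N : ℕ} {f g : EuclideanSpace ℝ (Fin N) → ℂ} (hf : Smo f) (hg : Smo g) (i : Fin N)
    (y : EuclideanSpace ℝ (Fin N)) :
    pdC i (fun y => f y * g y) y = f y * pdC i g y + g y * pdC i f y := by
  unfold pdC
  rw [fderiv_fun_mul (hf.diff y) (hg.diff y)]; simp

lemma pdC_const {N : ℕ} (c : ℂ) (i : Fin N) (y : EuclideanSpace ℝ (Fin N)) :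
    pdC i (fun _ => c) y = 0 := by
  simp [pdC]

lemma pdC_cmul {N : ℕ} {f : EuclideanSpace ℝ (Fin N) → ℂ} (hf : Smo f) (c : ℂ) (i : Fin N)
    (y : EuclideanSpace ℝ (Fin N)) :
    pdC i (fun y => c * f y) y = c * pdC i f y := by
  rw [pdC_mul (Smo.const c) hf, pdC_const]; ring

lemma pdC_sum {N : ℕ} {f : Fin N → EuclideanSpace ℝ (Fin N) → ℂ} (hf : ∀ i, Smo (f i)) (i : Fin N)
    (y : EuclideanSpace ℝ (Fin N)) :
    pdC i (fun y => ∑ j, f j y) y = ∑ j, pdC i (f j) y := by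
  unfold pdC
  rw [fderiv_fun_sum (fun j _ => (hf j).diff y)]; simp

lemma pdC_coord {N : ℕ} (i j : Fin N) (y : EuclideanSpace ℝ (Fin N)) :
    pdC i (fun y : EuclideanSpace ℝ (Fin N) => (y j : ℂ)) y = if j = i then 1 else 0 := by
  unfold pdC
  have h : HasFDerivAt (fun y : EuclideanSpace ℝ (Fin N) => (y j : ℂ))
      (Complex.ofRealCLM.comp (EuclideanSpace.proj j : EuclideanSpace ℝ (Fin N) →L[ℝ] ℝ)) y :=
    (Complex.ofRealCLM.comp
      (EuclideanSpace.proj j : EuclideanSpace ℝ (Fin N) →L[ℝ] ℝ)).hasFDerivAt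
  rw [h.fderiv]
  by_cases hji : j = i <;> simp [hji]

lemma pdC_comm {N : ℕ} {f : EuclideanSpace ℝ (Fin N) → ℂ} (hf : Smo f) (i j : Fin N)
    (y : EuclideanSpace ℝ (Fin N)) : pdC i (pdC j f) y = pdC j (pdC i f) y := by
  have hd : Differentiable ℝ (fderiv ℝ f) :=
    (ContDiff.fderiv_right (m := (⊤ : ℕ∞)) hf (by simp)).differentiable (by simp)
  have key : ∀ a b : Fin N, pdC a (pdC b f) y
      = fderiv ℝ (fderiv ℝ f) y (EuclideanSpace.single a 1) (EuclideanSpace.single b 1) := by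
    intro a b
    have h : HasFDerivAt (pdC b f) _ y :=
      (hd y).hasFDerivAt.clm_apply (hasFDerivAt_const (EuclideanSpace.single b (1 : ℝ)) y)
    unfold pdC at h ⊢
    rw [h.fderiv]; simp
  have hs : IsSymmSndFDerivAt ℝ f y :=
    ContDiffAt.isSymmSndFDerivAt (n := (⊤ : ℕ∞)) (ContDiff.contDiffAt hf)
      (by simpa using WithTop.coe_le_coe.2 (le_top : (2 : ℕ∞) ≤ ⊤))
  rw [key, key]; exact hs _ _

lemma pdC_congr {N : ℕ} {f g : EuclideanSpace ℝ (Fin N) → ℂ} {s : Set (EuclideanSpace ℝ (Fin N))}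
    (hs : IsOpen s) (h : ∀ y ∈ s, f y = g y) (i : Fin N) {y : EuclideanSpace ℝ (Fin N)}
    (hy : y ∈ s) : pdC i f y = pdC i g y := by
  unfold pdC
  rw [Filter.EventuallyEq.fderiv_eq (Filter.eventuallyEq_of_mem (hs.mem_nhds hy) h)]

/-- Euler operator. -/
def Eu {N : ℕ} (f : EuclideanSpace ℝ (Fin N) → ℂ) (y : EuclideanSpace ℝ (Fin N)) : ℂ :=
  ∑ i, (y i : ℂ) * pdC i f y

/-- Laplacian. -/
def Lp {N : ℕ} (f : EuclideanSpace ℝ (Fin N) → ℂ) (y : EuclideanSpace ℝ (Fin N)) : ℂ :=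
  ∑ i, pdC i (pdC i f) y

lemma Smo.Eu {N : ℕ} {f : EuclideanSpace ℝ (Fin N) → ℂ} (hf : Smo f) : Smo (Eu f) :=
  Smo.sum (fun i => (Smo.coord i).mul (hf.pdC i))

lemma Smo.Lp {N : ℕ} {f : EuclideanSpace ℝ (Fin N) → ℂ} (hf : Smo f) : Smo (Lp f) :=
  Smo.sum (fun i => (hf.pdC i).pdC i)

lemma Eu_add {N : ℕ} {f g : EuclideanSpace ℝ (Fin N) → ℂ} (hf : Smo f) (hg : Smo g)
    (y : EuclideanSpace ℝ (Fin N)) :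
    Eu (fun y => f y + g y) y = Eu f y + Eu g y := by
  simp only [Eu, pdC_add hf hg, mul_add, Finset.sum_add_distrib]

lemma Eu_mul {N : ℕ} {f g : EuclideanSpace ℝ (Fin N) → ℂ} (hf : Smo f) (hg : Smo g)
    (y : EuclideanSpace ℝ (Fin N)) :
    Eu (fun y => f y * g y) y = f y * Eu g y + g y * Eu f y := by
  simp only [Eu, pdC_mul hf hg, Finset.mul_sum, ← Finset.sum_add_distrib]
  exact Finset.sum_congr rfl (fun i _ => by ring)

lemma Eu_cmul {N : ℕ} {f : EuclideanSpace ℝ (Fin N) → ℂ} (hf : Smo f) (c : ℂ)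
    (y : EuclideanSpace ℝ (Fin N)) :
    Eu (fun y => c * f y) y = c * Eu f y := by
  simp only [Eu, pdC_cmul hf, Finset.mul_sum]
  exact Finset.sum_congr rfl (fun i _ => by ring)

lemma Lp_add {N : ℕ} {f g : EuclideanSpace ℝ (Fin N) → ℂ} (hf : Smo f) (hg : Smo g)
    (y : EuclideanSpace ℝ (Fin N)) :
    Lp (fun y => f y + g y) y = Lp f y + Lp g y := by
  have h : ∀ i, pdC i (fun y => f y + g y) = fun y => pdC i f y + pdC i g y :=
    fun i => funext (pdC_add hf hg i)
  simp only [Lp, h, pdC_add (hf.pdC _) (hg.pdC _), Finset.sum_add_distrib]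

lemma Lp_cmul {N : ℕ} {f : EuclideanSpace ℝ (Fin N) → ℂ} (hf : Smo f) (c : ℂ)
    (y : EuclideanSpace ℝ (Fin N)) :
    Lp (fun y => c * f y) y = c * Lp f y := by
  have h : ∀ i, pdC i (fun y => c * f y) = fun y => c * pdC i f y :=
    fun i => funext (pdC_cmul hf c i)
  simp only [Lp, h, pdC_cmul (hf.pdC _), Finset.mul_sum]

lemma Eu_congr {N : ℕ} {f g : EuclideanSpace ℝ (Fin N) → ℂ} {s : Set (EuclideanSpace ℝ (Fin N))}
    (hs : IsOpen s) (h : ∀ y ∈ s, f y = g y) {y : EuclideanSpace ℝ (Fin N)}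
    (hy : y ∈ s) : Eu f y = Eu g y := by
  simp only [Eu, pdC_congr hs h _ hy]

lemma pdC_Eu {N : ℕ} {f : EuclideanSpace ℝ (Fin N) → ℂ} (hf : Smo f) (i : Fin N)
    (y : EuclideanSpace ℝ (Fin N)) :
    pdC i (Eu f) y = Eu (pdC i f) y + pdC i f y := by
  have h := pdC_sum (fun j => (Smo.coord j).mul (hf.pdC j)) i y
  have h2 : pdC i (Eu f) y = pdC i (fun y => ∑ j, (y j : ℂ) * pdC j f y) y := rfl
  rw [h2, h]
  simp only [pdC_mul (Smo.coord _) (hf.pdC _), pdC_coord, Finset.sum_add_distrib, Eu,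
    pdC_comm hf i]
  simp

lemma Lp_pdC {N : ℕ} {f : EuclideanSpace ℝ (Fin N) → ℂ} (hf : Smo f) (i : Fin N)
    (y : EuclideanSpace ℝ (Fin N)) :
    Lp (pdC i f) y = pdC i (Lp f) y := by
  have h := pdC_sum (fun j => (hf.pdC j).pdC j) i y
  have h2 : pdC i (Lp f) y = pdC i (fun y => ∑ j, pdC j (pdC j f) y) y := rfl
  rw [h2, h]
  unfold Lp
  refine Finset.sum_congr rfl (fun j _ => ?_)
  rw [pdC_comm (hf.pdC j) i j, funext (pdC_comm hf j i)]

lemma Lp_Eu {N : ℕ} {f : EuclideanSpace ℝ (Fin N) → ℂ} (hf : Smo f)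
    (y : EuclideanSpace ℝ (Fin N)) :
    Lp (Eu f) y = Eu (Lp f) y + 2 * Lp f y := by
  have h1 : ∀ i, pdC i (pdC i (Eu f)) y
      = Eu (pdC i (pdC i f)) y + 2 * pdC i (pdC i f) y := by
    intro i
    rw [funext (pdC_Eu hf i), pdC_add (hf.pdC i).Eu (hf.pdC i), pdC_Eu (hf.pdC i)]
    ring
  have h2 : Eu (Lp f) y = ∑ i, Eu (pdC i (pdC i f)) y := by
    have h3 : ∀ j, pdC j (Lp f) y = ∑ i, pdC j (pdC i (pdC i f)) y := fun j =>
      pdC_sum (fun i => (hf.pdC i).pdC i) j y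
    simp only [Eu, h3, Finset.mul_sum]
    exact Finset.sum_comm
  rw [h2]
  simp only [Lp, h1, Finset.sum_add_distrib, Finset.mul_sum]

lemma hess_eq {N : ℕ} {f : EuclideanSpace ℝ (Fin N) → ℂ} (hf : Smo f)
    (y : EuclideanSpace ℝ (Fin N)) :
    (∑ i : Fin N, ∑ j : Fin N,
        (((y i * y j - if i = j then (1 : ℝ) else 0) : ℝ) : ℂ) * pdC i (pdC j f) y)
      = Eu (Eu f) y - Eu f y - Lp f y := by
  have h1 : Eu (Eu f) y - Eu f y = ∑ i, ∑ j, (y i : ℂ) * (y j : ℂ) * pdC i (pdC j f) y := by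
    have : Eu (Eu f) y = ∑ i, (y i : ℂ) * (Eu (pdC i f) y + pdC i f y) := by
      simp only [← pdC_Eu hf]; rfl
    rw [this]
    simp only [mul_add, Finset.sum_add_distrib]
    rw [show ∑ i, (y i : ℂ) * pdC i f y = Eu f y from rfl, add_sub_cancel_right]
    simp only [Eu, Finset.mul_sum]
    refine Finset.sum_congr rfl (fun i _ => Finset.sum_congr rfl (fun j _ => ?_))
    rw [pdC_comm hf j i]; ring
  rw [h1]
  simp only [Complex.ofReal_sub, sub_mul, Finset.sum_sub_distrib, Complex.ofReal_mul]
  congr 1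
  unfold Lp
  refine Finset.sum_congr rfl (fun i _ => ?_)
  rw [Finset.sum_eq_single i]
  · simp
  · intro j _ hj; simp [hj.symm]
  · simp

/-- The free operator. -/
def Pm {N : ℕ} (μ : ℂ) (f : EuclideanSpace ℝ (Fin N) → ℂ) (y : EuclideanSpace ℝ (Fin N)) : ℂ :=
  Eu (Eu f) y + (2 * μ + 1) * Eu f y + μ * (μ + 1) * f y + (-1) * Lp f y

/-- The twisted derivative. -/
def Xd {N : ℕ} (d : EuclideanSpace ℝ (Fin N)) (μ : ℂ) (i : Fin N)
    (f : EuclideanSpace ℝ (Fin N) → ℂ) (y : EuclideanSpace ℝ (Fin N)) : ℂ :=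
  pdC i f y + (d i : ℂ) * (Eu f y + μ * f y)

/-- The function `1 + d·y`. -/
def qf {N : ℕ} (d : EuclideanSpace ℝ (Fin N)) (y : EuclideanSpace ℝ (Fin N)) : ℂ :=
  1 + ∑ i, (d i : ℂ) * (y i : ℂ)

lemma Smo.qf {N : ℕ} (d : EuclideanSpace ℝ (Fin N)) : Smo (qf d) :=
  (Smo.const 1).add (Smo.sum fun i => (Smo.const _).mul (Smo.coord i))

lemma pdC_qf {N : ℕ} (d : EuclideanSpace ℝ (Fin N)) (i : Fin N) (y : EuclideanSpace ℝ (Fin N)) :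
    pdC i (qf d) y = d i := by
  have h : pdC i (qf d) y = pdC i (fun y => 1 + ∑ i, (d i : ℂ) * (y i : ℂ)) y := rfl
  rw [h, pdC_add (Smo.const 1) (Smo.sum fun i => (Smo.const _).mul (Smo.coord i)),
    pdC_sum (fun i => (Smo.const _).mul (Smo.coord i)), pdC_const]
  simp only [pdC_cmul (Smo.coord _), pdC_coord]
  simp

lemma Eu_qf {N : ℕ} (d : EuclideanSpace ℝ (Fin N)) (y : EuclideanSpace ℝ (Fin N)) :
    Eu (qf d) y = qf d y - 1 := by
  simp only [Eu, pdC_qf, qf]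
  rw [add_sub_cancel_left]
  exact Finset.sum_congr rfl fun i _ => mul_comm _ _

lemma Smo.Pm {N : ℕ} {f : EuclideanSpace ℝ (Fin N) → ℂ} (hf : Smo f) (μ : ℂ) : Smo (Pm μ f) :=
  ((hf.Eu.Eu.add ((Smo.const _).mul hf.Eu)).add ((Smo.const _).mul hf)).add
    ((Smo.const _).mul hf.Lp)

lemma Smo.Xd {N : ℕ} {f : EuclideanSpace ℝ (Fin N) → ℂ} (hf : Smo f)
    (d : EuclideanSpace ℝ (Fin N)) (μ : ℂ) (i : Fin N) : Smo (Xd d μ i f) :=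
  (hf.pdC i).add ((Smo.const _).mul (hf.Eu.add ((Smo.const _).mul hf)))

lemma pdC_Pm {N : ℕ} {f : EuclideanSpace ℝ (Fin N) → ℂ} (hf : Smo f) (μ : ℂ) (i : Fin N)
    (y : EuclideanSpace ℝ (Fin N)) : pdC i (Pm μ f) y = Pm (μ + 1) (pdC i f) y := by
  have h : pdC i (Pm μ f) y = pdC i (fun y => Eu (Eu f) y + (2 * μ + 1) * Eu f y
    + μ * (μ + 1) * f y + (-1) * Lp f y) y := rfl
  rw [h, pdC_add ((hf.Eu.Eu.add ((Smo.const _).mul hf.Eu)).add ((Smo.const _).mul hf))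
      ((Smo.const _).mul hf.Lp),
    pdC_add (hf.Eu.Eu.add ((Smo.const _).mul hf.Eu)) ((Smo.const _).mul hf),
    pdC_add hf.Eu.Eu ((Smo.const _).mul hf.Eu), pdC_cmul hf.Eu, pdC_cmul hf, pdC_cmul hf.Lp,
    pdC_Eu hf.Eu, funext (pdC_Eu hf i), Eu_add (hf.pdC i).Eu (hf.pdC i), ← Lp_pdC hf]
  unfold Pm
  ring

lemma Pm_add {N : ℕ} {f g : EuclideanSpace ℝ (Fin N) → ℂ} (hf : Smo f) (hg : Smo g) (μ : ℂ)
    (y : EuclideanSpace ℝ (Fin N)) :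
    Pm μ (fun y => f y + g y) y = Pm μ f y + Pm μ g y := by
  unfold Pm
  rw [Lp_add hf hg, funext (Eu_add hf hg), Eu_add hf.Eu hg.Eu]; ring

lemma Pm_cmul {N : ℕ} {f : EuclideanSpace ℝ (Fin N) → ℂ} (hf : Smo f) (μ c : ℂ)
    (y : EuclideanSpace ℝ (Fin N)) :
    Pm μ (fun y => c * f y) y = c * Pm μ f y := by
  unfold Pm
  rw [Lp_cmul hf, funext (Eu_cmul hf c), Eu_cmul hf.Eu]; ring

lemma Pm_Eu {N : ℕ} {f : EuclideanSpace ℝ (Fin N) → ℂ} (hf : Smo f) (μ : ℂ)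
    (y : EuclideanSpace ℝ (Fin N)) :
    Pm (μ + 1) (Eu f) y + μ * Pm (μ + 1) f y = Eu (Pm μ f) y + (μ + 2) * Pm μ f y := by
  have h : Eu (Pm μ f) y = Eu (fun y => Eu (Eu f) y + (2 * μ + 1) * Eu f y
    + μ * (μ + 1) * f y + (-1) * Lp f y) y := rfl
  rw [h, Eu_add ((hf.Eu.Eu.add ((Smo.const _).mul hf.Eu)).add ((Smo.const _).mul hf))
      ((Smo.const _).mul hf.Lp),
    Eu_add (hf.Eu.Eu.add ((Smo.const _).mul hf.Eu)) ((Smo.const _).mul hf),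
    Eu_add hf.Eu.Eu ((Smo.const _).mul hf.Eu), Eu_cmul hf.Eu, Eu_cmul hf, Eu_cmul hf.Lp]
  unfold Pm
  rw [Lp_Eu hf]
  ring

/-- Smooth solutions of the eigen-equation on the open unit ball, in polynomial form. -/
def Sol {N : ℕ} (d : EuclideanSpace ℝ (Fin N)) (c : ℂ) (μ : ℂ)
    (f : EuclideanSpace ℝ (Fin N) → ℂ) : Prop :=
  Smo f ∧ ∀ y ∈ Metric.ball (0 : EuclideanSpace ℝ (Fin N)) 1, qf d y ^ 2 * Pm μ f y = c * f y

lemma Sol.step {N : ℕ} {d : EuclideanSpace ℝ (Fin N)} {c μ : ℂ}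
    {f : EuclideanSpace ℝ (Fin N) → ℂ} (hf : Sol d c μ f) (i : Fin N) :
    Sol d c (μ + 1) (Xd d μ i f) := by
  obtain ⟨hs, he⟩ := hf
  refine ⟨hs.Xd d μ i, fun y hy => ?_⟩
  have he' : ∀ y ∈ Metric.ball (0 : EuclideanSpace ℝ (Fin N)) 1,
      qf d y * (qf d y * Pm μ f y) = c * f y := fun y hy => by rw [← he y hy]; ring
  have h1 := pdC_congr Metric.isOpen_ball he' i hy
  have h2 := Eu_congr Metric.isOpen_ball he' hy
  have h0 := he' y hy
  rw [pdC_mul (Smo.qf d) ((Smo.qf d).mul (hs.Pm μ)), pdC_mul (Smo.qf d) (hs.Pm μ), pdC_qf,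
    pdC_cmul hs] at h1
  rw [Eu_mul (Smo.qf d) ((Smo.qf d).mul (hs.Pm μ)), Eu_mul (Smo.qf d) (hs.Pm μ), Eu_qf,
    Eu_cmul hs] at h2
  have h3 : Pm (μ + 1) (Xd d μ i f) y
      = Pm (μ + 1) (pdC i f) y + d i * (Pm (μ + 1) (Eu f) y + μ * Pm (μ + 1) f y) := by
    have : Pm (μ + 1) (Xd d μ i f) y
      = Pm (μ + 1) (fun y => pdC i f y + (d i : ℂ) * (Eu f y + μ * f y)) y := rfl
    rw [this, Pm_add (hs.pdC i) ((Smo.const _).mul (hs.Eu.add ((Smo.const _).mul hs))),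
      Pm_cmul (hs.Eu.add ((Smo.const _).mul hs)), Pm_add hs.Eu ((Smo.const _).mul hs),
      Pm_cmul hs]
  rw [h3, ← pdC_Pm hs, Pm_Eu hs]
  unfold Xd
  linear_combination h1 + (d i : ℂ) * h2 + (d i : ℂ) * μ * h0

lemma Sol.final {N : ℕ} {d : EuclideanSpace ℝ (Fin N)} {c μ : ℂ}
    {f : EuclideanSpace ℝ (Fin N) → ℂ} (hf : Sol d c μ f)
    (hX : ∀ i, ∀ y ∈ Metric.ball (0 : EuclideanSpace ℝ (Fin N)) 1, Xd d μ i f y = 0)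
    {y : EuclideanSpace ℝ (Fin N)} (hy : y ∈ Metric.ball (0 : EuclideanSpace ℝ (Fin N)) 1)
    (hfy : f y ≠ 0) : μ * (μ + 1) * (1 - ∑ i, (d i : ℂ) ^ 2) = c := by
  obtain ⟨hs, he⟩ := hf
  have hA : ∀ y ∈ Metric.ball (0 : EuclideanSpace ℝ (Fin N)) 1,
      qf d y * Eu f y = (-μ) * (qf d y * f y) + μ * f y := by
    intro y hy
    have h1 : Eu f y = ∑ i, (y i : ℂ) * (- (d i : ℂ) * (Eu f y + μ * f y)) := by
      conv_lhs => unfold Eu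
      refine Finset.sum_congr rfl fun i _ => ?_
      have := hX i y hy
      unfold Xd at this
      linear_combination (y i : ℂ) * this
    have h2 : ∑ i, (y i : ℂ) * (- (d i : ℂ) * (Eu f y + μ * f y))
        = -(qf d y - 1) * (Eu f y + μ * f y) := by
      unfold qf
      rw [add_sub_cancel_left, ← Finset.sum_neg_distrib, Finset.sum_mul]
      exact Finset.sum_congr rfl fun i _ => by ring
    rw [h2] at h1
    linear_combination h1
  have hB : ∀ i, ∀ y ∈ Metric.ball (0 : EuclideanSpace ℝ (Fin N)) 1,
      qf d y * pdC i f y = (-(d i : ℂ) * μ) * f y := by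
    intro i y hy
    have := hX i y hy
    unfold Xd at this
    linear_combination qf d y * this - (d i : ℂ) * hA y hy
  have hA' := Eu_congr Metric.isOpen_ball hA hy
  rw [Eu_mul (Smo.qf d) hs.Eu,
    Eu_add ((Smo.const _).mul ((Smo.qf d).mul hs)) ((Smo.const _).mul hs),
    Eu_cmul ((Smo.qf d).mul hs), Eu_cmul hs, Eu_mul (Smo.qf d) hs, Eu_qf] at hA'
  have hB' : ∀ i, qf d y ^ 2 * pdC i (pdC i f) y = μ * (μ + 1) * f y * (d i : ℂ) ^ 2 := by
    intro i
    have h := pdC_congr Metric.isOpen_ball (hB i) i hy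
    rw [pdC_mul (Smo.qf d) (hs.pdC i), pdC_cmul hs, pdC_qf] at h
    linear_combination qf d y * h - (d i : ℂ) * (μ + 1) * hB i y hy
  have hL : qf d y ^ 2 * Lp f y = μ * (μ + 1) * f y * ∑ i, (d i : ℂ) ^ 2 := by
    unfold Lp
    rw [Finset.mul_sum, Finset.mul_sum]
    exact Finset.sum_congr rfl fun i _ => hB' i
  have h0 := he y hy
  have hAy := hA y hy
  unfold Pm at h0
  apply mul_right_cancel₀ hfy
  linear_combination h0 + hL - qf d y * hA' - (μ * qf d y + 1 + μ) * hAy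

/-! ### Energy estimate -/

open scoped ComplexConjugate

lemma Smo.conj {N : ℕ} {f : EuclideanSpace ℝ (Fin N) → ℂ} (hf : Smo f) :
    Smo (fun y => conj (f y)) := Complex.conjCLE.contDiff.comp hf

lemma pdC_conj {N : ℕ} {f : EuclideanSpace ℝ (Fin N) → ℂ} (hf : Smo f) (i : Fin N)
    (y : EuclideanSpace ℝ (Fin N)) : pdC i (fun y => conj (f y)) y = conj (pdC i f y) := by
  have h : HasFDerivAt (fun y => conj (f y))
      ((Complex.conjCLE : ℂ →L[ℝ] ℂ).comp (fderiv ℝ f y)) y :=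
    (Complex.conjCLE : ℂ →L[ℝ] ℂ).hasFDerivAt.comp y (hf.diff y).hasFDerivAt
  unfold pdC
  rw [h.fderiv]; simp

lemma Eu_conj {N : ℕ} {f : EuclideanSpace ℝ (Fin N) → ℂ} (hf : Smo f)
    (y : EuclideanSpace ℝ (Fin N)) : Eu (fun y => conj (f y)) y = conj (Eu f y) := by
  simp [Eu, pdC_conj hf]

lemma Eu_sum {N : ℕ} {f : Fin N → EuclideanSpace ℝ (Fin N) → ℂ} (hf : ∀ i, Smo (f i))
    (y : EuclideanSpace ℝ (Fin N)) :
    Eu (fun y => ∑ j, f j y) y = ∑ j, Eu (f j) y := by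
  simp only [Eu, pdC_sum hf, Finset.mul_sum]
  exact Finset.sum_comm

/-- Energy density built from `ψ` and `f`. -/
def en {N : ℕ} (ψ f : EuclideanSpace ℝ (Fin N) → ℂ) (y : EuclideanSpace ℝ (Fin N)) : ℂ :=
  conj (ψ y) * ψ y + ∑ j, conj (pdC j f y) * pdC j f y + conj (f y) * f y

/-- Energy flux. -/
def Jf {N : ℕ} (ψ f : EuclideanSpace ℝ (Fin N) → ℂ) (i : Fin N)
    (y : EuclideanSpace ℝ (Fin N)) : ℂ :=
  (1 / 2) * ((y i : ℂ) * en ψ f y) + (-1 / 2) * (conj (ψ y) * pdC i f y + ψ y * conj (pdC i f y))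

lemma Smo.en {N : ℕ} {ψ f : EuclideanSpace ℝ (Fin N) → ℂ} (hψ : Smo ψ) (hf : Smo f) :
    Smo (en ψ f) :=
  ((hψ.conj.mul hψ).add (Smo.sum fun j => (hf.pdC j).conj.mul (hf.pdC j))).add (hf.conj.mul hf)

lemma Smo.Jf {N : ℕ} {ψ f : EuclideanSpace ℝ (Fin N) → ℂ} (hψ : Smo ψ) (hf : Smo f) (i : Fin N) :
    Smo (Jf ψ f i) :=
  ((Smo.const _).mul ((Smo.coord i).mul (hψ.en hf))).add
    ((Smo.const _).mul ((hψ.conj.mul (hf.pdC i)).add (hψ.mul (hf.pdC i).conj)))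

lemma Eu_en {N : ℕ} {ψ f : EuclideanSpace ℝ (Fin N) → ℂ} (hψ : Smo ψ) (hf : Smo f)
    (y : EuclideanSpace ℝ (Fin N)) :
    Eu (en ψ f) y = (conj (ψ y) * Eu ψ y + ψ y * conj (Eu ψ y))
      + ∑ j, (conj (pdC j f y) * Eu (pdC j f) y + pdC j f y * conj (Eu (pdC j f) y))
      + (conj (f y) * Eu f y + f y * conj (Eu f y)) := by
  have h : Eu (en ψ f) y = Eu (fun y => conj (ψ y) * ψ y
    + ∑ j, conj (pdC j f y) * pdC j f y + conj (f y) * f y) y := rfl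
  rw [h, Eu_add ((hψ.conj.mul hψ).add (Smo.sum fun j => (hf.pdC j).conj.mul (hf.pdC j)))
      (hf.conj.mul hf),
    Eu_add (hψ.conj.mul hψ) (Smo.sum fun j => (hf.pdC j).conj.mul (hf.pdC j)),
    Eu_sum (fun j => (hf.pdC j).conj.mul (hf.pdC j)), Eu_mul hψ.conj hψ, Eu_mul hf.conj hf,
    Eu_conj hψ, Eu_conj hf]
  simp only [Eu_mul (hf.pdC _).conj (hf.pdC _), Eu_conj (hf.pdC _)]

lemma pdC_Jf {N : ℕ} {ψ f : EuclideanSpace ℝ (Fin N) → ℂ} (hψ : Smo ψ) (hf : Smo f) (i : Fin N)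
    (y : EuclideanSpace ℝ (Fin N)) :
    pdC i (Jf ψ f i) y = (1 / 2) * en ψ f y + (1 / 2) * ((y i : ℂ) * pdC i (en ψ f) y)
      + (-1 / 2) * (conj (pdC i ψ y) * pdC i f y + pdC i ψ y * conj (pdC i f y)
        + conj (ψ y) * pdC i (pdC i f) y + ψ y * conj (pdC i (pdC i f) y)) := by
  have h : pdC i (Jf ψ f i) y = pdC i (fun y => (1 / 2) * ((y i : ℂ) * en ψ f y)
    + (-1 / 2) * (conj (ψ y) * pdC i f y + ψ y * conj (pdC i f y))) y := rfl
  rw [h, pdC_add ((Smo.const _).mul ((Smo.coord i).mul (hψ.en hf)))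
      ((Smo.const _).mul ((hψ.conj.mul (hf.pdC i)).add (hψ.mul (hf.pdC i).conj))),
    pdC_cmul ((Smo.coord i).mul (hψ.en hf)),
    pdC_cmul ((hψ.conj.mul (hf.pdC i)).add (hψ.mul (hf.pdC i).conj)),
    pdC_add (hψ.conj.mul (hf.pdC i)) (hψ.mul (hf.pdC i).conj),
    pdC_mul (Smo.coord i) (hψ.en hf), pdC_mul hψ.conj (hf.pdC i), pdC_mul hψ (hf.pdC i).conj,
    pdC_conj hψ, pdC_conj (hf.pdC i), pdC_coord]
  simp only [if_true]
  ring

lemma div_Jf {N : ℕ} {f : EuclideanSpace ℝ (Fin N) → ℂ} (hf : Smo f) (μ v : ℂ)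
    (ψ : EuclideanSpace ℝ (Fin N) → ℂ) (hψd : ψ = fun y => Eu f y + μ * f y)
    (y : EuclideanSpace ℝ (Fin N)) (he : Pm μ f y = v * f y) :
    ∑ i, pdC i (Jf ψ f i) y = (N / 2 : ℂ) * en ψ f y
      + (1 / 2) * (conj (ψ y) * v * f y + ψ y * conj v * conj (f y))
      - (1 / 2) * (μ + conj μ) * en ψ f y
      - (conj (ψ y) * ψ y + ∑ j, conj (pdC j f y) * pdC j f y)
      + (1 / 2) * (conj (f y) * ψ y + f y * conj (ψ y)) := by
  have hψ : Smo ψ := by rw [hψd]; exact hf.Eu.add ((Smo.const _).mul hf)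
  have h1 : Eu f y = ψ y - μ * f y := by rw [hψd]; ring
  have h2 : Eu ψ y = Lp f y + v * f y - (μ + 1) * ψ y := by
    rw [← he, hψd, Eu_add hf.Eu ((Smo.const _).mul hf), Eu_cmul hf]
    unfold Pm; ring
  have h3 : ∀ j, Eu (pdC j f) y = pdC j ψ y - (1 + μ) * pdC j f y := by
    intro j
    rw [hψd, pdC_add hf.Eu ((Smo.const _).mul hf), pdC_cmul hf, pdC_Eu hf]; ring
  have h4 : ∑ j, (conj (pdC j f y) * Eu (pdC j f) y + pdC j f y * conj (Eu (pdC j f) y))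
      = ∑ j, (conj (pdC j ψ y) * pdC j f y + pdC j ψ y * conj (pdC j f y))
        - (2 + μ + conj μ) * ∑ j, conj (pdC j f y) * pdC j f y := by
    rw [Finset.mul_sum, ← Finset.sum_sub_distrib]
    refine Finset.sum_congr rfl fun j _ => ?_
    rw [h3]; simp only [map_sub, map_mul, map_add, map_one]; ring
  have h5 : ∑ i, pdC i (Jf ψ f i) y = (N / 2 : ℂ) * en ψ f y + (1 / 2) * Eu (en ψ f) y
      + (-1 / 2) * (∑ j, (conj (pdC j ψ y) * pdC j f y + pdC j ψ y * conj (pdC j f y))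
        + conj (ψ y) * Lp f y + ψ y * conj (Lp f y)) := by
    simp only [pdC_Jf hψ hf, Finset.sum_add_distrib, ← Finset.mul_sum]
    have : ∑ i, (y i : ℂ) * pdC i (en ψ f) y = Eu (en ψ f) y := rfl
    rw [this]
    have : ∑ i, pdC i (pdC i f) y = Lp f y := rfl
    rw [this]
    have : ∑ i, conj (pdC i (pdC i f) y) = conj (Lp f y) := by simp [Lp]
    rw [this]
    simp
    ring
  rw [h5, Eu_en hψ hf, h4, h2, h1]
  simp only [map_sub, map_mul, map_add, map_one]
  unfold en
  ring

/-- The scalar cut-off `max 0 (1 - |y|²)`. -/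
def Mf {N : ℕ} (y : EuclideanSpace ℝ (Fin N)) : ℝ := max 0 (1 - ‖y‖ ^ 2)

lemma hasDerivAt_maxsq (x : ℝ) : HasDerivAt (fun x : ℝ => (max 0 x) ^ 2) (2 * max 0 x) x := by
  rcases lt_trichotomy x 0 with h | h | h
  · rw [max_eq_left h.le]
    have : (fun x : ℝ => (max 0 x) ^ 2) =ᶠ[nhds x] fun _ => 0 := by
      filter_upwards [Iio_mem_nhds h] with z hz
      rw [max_eq_left (le_of_lt hz)]; simp
    simpa using (hasDerivAt_const x (0 : ℝ)).congr_of_eventuallyEq this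
  · subst h
    rw [hasDerivAt_iff_isLittleO_nhds_zero]
    simp only [zero_add, max_self, mul_zero, smul_zero, sub_zero, ne_eq, OfNat.ofNat_ne_zero,
      not_false_eq_true, zero_pow]
    have h1 : (fun h : ℝ => (max 0 h) ^ 2) =O[nhds 0] fun h : ℝ => h ^ 2 := by
      refine Asymptotics.IsBigO.of_bound 1 (Filter.Eventually.of_forall fun h => ?_)
      rw [one_mul, Real.norm_eq_abs, Real.norm_eq_abs, abs_of_nonneg (sq_nonneg _),
        abs_of_nonneg (sq_nonneg _)]
      rcases le_total 0 h with hh | hh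
      · rw [max_eq_right hh]
      · rw [max_eq_left hh]; nlinarith [sq_nonneg h]
    exact h1.trans_isLittleO (Asymptotics.isLittleO_pow_id one_lt_two)
  · rw [max_eq_right h.le]
    have : (fun x : ℝ => (max 0 x) ^ 2) =ᶠ[nhds x] fun x => x ^ 2 := by
      filter_upwards [Ioi_mem_nhds h] with z hz
      rw [max_eq_right (le_of_lt hz)]
    simpa using (hasDerivAt_pow 2 x).congr_of_eventuallyEq this

/-- The weight as a complex function. -/
def Wf {N : ℕ} (y : EuclideanSpace ℝ (Fin N)) : ℂ := ((Mf y ^ 2 : ℝ) : ℂ)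

lemma Wf_hasFDerivAt {N : ℕ} (y : EuclideanSpace ℝ (Fin N)) :
    HasFDerivAt (Wf : EuclideanSpace ℝ (Fin N) → ℂ) (Complex.ofRealCLM.comp
      ((2 * Mf y) • (-(2 • innerSL ℝ y)))) y := by
  have h1 : HasFDerivAt (fun y : EuclideanSpace ℝ (Fin N) => 1 - ‖y‖ ^ 2)
      (-(2 • innerSL ℝ y)) y := by
    simpa using (hasStrictFDerivAt_norm_sq y).hasFDerivAt.const_sub 1
  have h2 := (hasDerivAt_maxsq (1 - ‖y‖ ^ 2)).comp_hasFDerivAt y h1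
  exact Complex.ofRealCLM.hasFDerivAt.comp y h2

lemma pdC_Wf {N : ℕ} (i : Fin N) (y : EuclideanSpace ℝ (Fin N)) :
    pdC i Wf y = -4 * (Mf y : ℂ) * (y i : ℂ) := by
  unfold pdC
  rw [(Wf_hasFDerivAt y).fderiv]
  have h : inner ℝ y (EuclideanSpace.single i (1 : ℝ)) = y i := by
    rw [EuclideanSpace.inner_single_right]; simp
  simp [h]
  ring

lemma Mf_cont {N : ℕ} : Continuous (Mf : EuclideanSpace ℝ (Fin N) → ℝ) := by
  unfold Mf; fun_prop

lemma Mf_zero {N : ℕ} {y : EuclideanSpace ℝ (Fin N)}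
    (hy : y ∉ Metric.ball (0 : EuclideanSpace ℝ (Fin N)) 1) : Mf y = 0 := by
  rw [Metric.mem_ball, dist_zero_right, not_lt] at hy
  exact max_eq_left (by nlinarith)

lemma Mf_pos {N : ℕ} {y : EuclideanSpace ℝ (Fin N)}
    (hy : y ∈ Metric.ball (0 : EuclideanSpace ℝ (Fin N)) 1) :
    Mf y = 1 - ‖y‖ ^ 2 ∧ 0 < Mf y := by
  rw [Metric.mem_ball, dist_zero_right] at hy
  have h : 0 < 1 - ‖y‖ ^ 2 := by nlinarith [norm_nonneg y]
  have h2 : Mf y = 1 - ‖y‖ ^ 2 := max_eq_right h.le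
  exact ⟨h2, h2 ▸ h⟩

lemma pdC_WJ {N : ℕ} {g : EuclideanSpace ℝ (Fin N) → ℂ} (hg : Smo g) (i : Fin N)
    (y : EuclideanSpace ℝ (Fin N)) :
    pdC i (fun y => Wf y * g y) y
      = Wf y * pdC i g y + g y * (-4 * (Mf y : ℂ) * (y i : ℂ)) := by
  rw [← pdC_Wf]
  unfold pdC
  rw [fderiv_fun_mul (Wf_hasFDerivAt y).differentiableAt (hg.diff y)]; simp

lemma compact_int {N : ℕ} {g : EuclideanSpace ℝ (Fin N) → ℂ} (hg : Continuous g)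
    (h0 : ∀ y ∉ Metric.ball (0 : EuclideanSpace ℝ (Fin N)) 1, g y = 0) :
    MeasureTheory.Integrable g := by
  refine hg.integrable_of_hasCompactSupport
    (HasCompactSupport.intro (isCompact_closedBall (0 : EuclideanSpace ℝ (Fin N)) 1) ?_)
  intro y hy
  exact h0 y (fun h => hy (Metric.ball_subset_closedBall h))

lemma pdC_WJ_integrable {N : ℕ} {g : EuclideanSpace ℝ (Fin N) → ℂ} (hg : Smo g) (i : Fin N) :
    MeasureTheory.Integrable (pdC i (fun y => Wf y * g y)) := by
  rw [funext (pdC_WJ hg i)]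
  apply compact_int
  · have h1 : Continuous (Wf : EuclideanSpace ℝ (Fin N) → ℂ) :=
      Complex.continuous_ofReal.comp (Mf_cont.pow 2)
    have h2 : Continuous fun y : EuclideanSpace ℝ (Fin N) => (Mf y : ℂ) :=
      Complex.continuous_ofReal.comp Mf_cont
    exact (h1.mul (hg.pdC i).diff.continuous).add
      (hg.diff.continuous.mul ((continuous_const.mul h2).mul (Smo.coord i).diff.continuous))
  · intro y hy
    simp [Wf, Mf_zero hy]

lemma integral_pdC_WJ {N : ℕ} {g : EuclideanSpace ℝ (Fin N) → ℂ} (hg : Smo g) (i : Fin N) :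
    ∫ y, pdC i (fun y => Wf y * g y) y = 0 := by
  have hW : Differentiable ℝ (Wf : EuclideanSpace ℝ (Fin N) → ℂ) :=
    fun y => (Wf_hasFDerivAt y).differentiableAt
  have h := integral_mul_fderiv_eq_neg_fderiv_mul_of_integrable
    (μ := (MeasureTheory.volume : MeasureTheory.Measure (EuclideanSpace ℝ (Fin N))))
    (𝕜 := ℂ) (f := fun _ => (1 : ℂ)) (g := fun y => Wf y * g y)
    (v := EuclideanSpace.single i (1 : ℝ)) (by simp) (by
      simp only [one_mul]
      exact pdC_WJ_integrable hg i)
    (by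
      simp only [one_mul]
      apply compact_int (hW.continuous.mul hg.diff.continuous)
      intro y hy
      simp [Wf, Mf_zero hy])
    (fun x _ => differentiableAt_const _) (fun x _ => (hW x).mul (hg.diff x))
  simpa [pdC] using h

lemma real_ineq (n m Vm a h b r M R1 R2 R3 : ℝ) 
    (hr : 0 ≤ r) (hr1 : r < 1) (hM : M = 1 - r ^ 2) (hV : 0 ≤ Vm)
    (h1 : R1 ≤ Vm * (a * b)) (h2 : R2 ≤ a * b) (h3 : R3 ≤ a * (r * h))
    (hm : n / 2 + 3 + (Vm + 1) / 2 ≤ m) :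
    M ^ 2 * (n / 2 * (a ^ 2 + h ^ 2 + b ^ 2) + R1 - m * (a ^ 2 + h ^ 2 + b ^ 2) - (a ^ 2 + h ^ 2)
      + R2) - 4 * M * (1 / 2 * r ^ 2 * (a ^ 2 + h ^ 2 + b ^ 2) - R3)
      ≤ - (M ^ 2 * (a ^ 2 + h ^ 2 + b ^ 2)) := by
  set e := a ^ 2 + h ^ 2 + b ^ 2 with he
  have he0 : 0 ≤ e := by positivity
  have hM0 : 0 ≤ M := by rw [hM]; nlinarith
  have hab : a * b ≤ e / 2 := by nlinarith [sq_nonneg (a - b), sq_nonneg h]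
  have hah : a * h ≤ e / 2 := by nlinarith [sq_nonneg (a - h), sq_nonneg b]
  have hR1 : R1 ≤ Vm * (e / 2) := h1.trans (mul_le_mul_of_nonneg_left hab hV)
  have hR3 : R3 ≤ r * (e / 2) := by
    refine h3.trans ?_
    calc a * (r * h) = r * (a * h) := by ring
      _ ≤ _ := mul_le_mul_of_nonneg_left hah hr
  have hA : n / 2 * e + R1 - m * e - (a ^ 2 + h ^ 2) + R2 ≤ -3 * e := by
    have := mul_le_mul_of_nonneg_right hm he0
    nlinarith [sq_nonneg a, sq_nonneg h]
  have hB : -(4 * M * (1 / 2 * r ^ 2 * e - R3)) ≤ 2 * M ^ 2 * e := by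
    have h5 : -(4 * M * (1 / 2 * r ^ 2 * e - R3)) ≤ 4 * M * (r * (e / 2) - 1 / 2 * r ^ 2 * e) := by
      nlinarith
    have h6 : r * (e / 2) - 1 / 2 * r ^ 2 * e ≤ 1 / 2 * M * e := by
      rw [hM]; nlinarith
    nlinarith
  have hC := mul_le_mul_of_nonneg_left hA (sq_nonneg M)
  nlinarith

lemma energy {N : ℕ} {f : EuclideanSpace ℝ (Fin N) → ℂ} (hf : Smo f) (μ : ℂ) (Vm : ℝ)
    (hV : 0 ≤ Vm)
    (he : ∀ y ∈ Metric.ball (0 : EuclideanSpace ℝ (Fin N)) 1, ∃ v : ℂ, ‖v‖ ≤ Vm ∧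
      Pm μ f y = v * f y)
    (hm : (N : ℝ) / 2 + 3 + (Vm + 1) / 2 ≤ μ.re) :
    ∀ y ∈ Metric.ball (0 : EuclideanSpace ℝ (Fin N)) 1, f y = 0 := by
  obtain ⟨ψ, hψd⟩ : ∃ ψ, ψ = fun y => Eu f y + μ * f y := ⟨_, rfl⟩
  have hψ : Smo ψ := by rw [hψd]; exact hf.Eu.add ((Smo.const _).mul hf)
  obtain ⟨er, her⟩ : ∃ er : EuclideanSpace ℝ (Fin N) → ℝ,
      er = fun y => ‖ψ y‖ ^ 2 + ∑ j, ‖pdC j f y‖ ^ 2 + ‖f y‖ ^ 2 := ⟨_, rfl⟩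
  have hen : ∀ y, en ψ f y = (er y : ℂ) := by
    intro y; simp [en, her, Complex.conj_mul']
  let G : EuclideanSpace ℝ (Fin N) → ℂ := fun y => ∑ i, pdC i (fun y => Wf y * Jf ψ f i y) y
  have hGi : MeasureTheory.Integrable G :=
    MeasureTheory.integrable_finsetSum _ fun i _ => pdC_WJ_integrable (hψ.Jf hf i) i
  have hG0 : ∫ y, G y = 0 := by
    rw [MeasureTheory.integral_finsetSum _ fun i _ => pdC_WJ_integrable (hψ.Jf hf i) i]
    exact Finset.sum_eq_zero fun i _ => integral_pdC_WJ (hψ.Jf hf i) i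
  have hGre : ∫ y, (G y).re = 0 := by
    have := integral_re hGi
    simp only [RCLike.re_to_complex] at this
    rw [this, hG0]; simp
  have hle : ∀ y, (G y).re ≤ -(Mf y ^ 2 * er y) := by
    intro y
    by_cases hy : y ∈ Metric.ball (0 : EuclideanSpace ℝ (Fin N)) 1
    swap
    · have : G y = 0 := by
        simp only [G, pdC_WJ (hψ.Jf hf _)]; simp [Wf, Mf_zero hy]
      rw [this, Mf_zero hy]; simp
    obtain ⟨v, hv, hev⟩ := he y hy
    have hJy : ∑ i, Jf ψ f i y * (y i : ℂ) = (1 / 2) * ((‖y‖ ^ 2 : ℝ) : ℂ) * en ψ f y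
        - (1 / 2) * (conj (ψ y) * Eu f y + ψ y * conj (Eu f y)) := by
      rw [EuclideanSpace.real_norm_sq_eq]
      simp only [Jf, Eu, map_sum, map_mul, Complex.conj_ofReal, Complex.ofReal_sum,
        Complex.ofReal_pow, Finset.mul_sum, Finset.sum_mul, ← Finset.sum_add_distrib,
        ← Finset.sum_sub_distrib]
      exact Finset.sum_congr rfl fun i _ => by ring
    have hGy : G y = Wf y * ∑ i, pdC i (Jf ψ f i) y
        - 4 * (Mf y : ℂ) * ∑ i, Jf ψ f i y * (y i : ℂ) := by
      simp only [G, pdC_WJ (hψ.Jf hf _), Finset.mul_sum, ← Finset.sum_sub_distrib]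
      exact Finset.sum_congr rfl fun i _ => by ring
    rw [div_Jf hf μ v ψ hψd y hev, hJy, hen] at hGy
    set H : ℝ := ∑ j, ‖pdC j f y‖ ^ 2 with hH
    have hH0 : 0 ≤ H := Finset.sum_nonneg fun j _ => by positivity
    have hGr : (G y).re = Mf y ^ 2 * ((N : ℝ) / 2 * er y + (conj (ψ y) * v * f y).re
        - μ.re * er y - (‖ψ y‖ ^ 2 + H) + (conj (f y) * ψ y).re)
        - 4 * Mf y * (1 / 2 * ‖y‖ ^ 2 * er y - (conj (ψ y) * Eu f y).re) := by
      have e1 : conj (ψ y) * v * f y + ψ y * conj v * conj (f y)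
          = ((2 * (conj (ψ y) * v * f y).re : ℝ) : ℂ) := by
        rw [← Complex.add_conj]; simp
      have e2 : conj (f y) * ψ y + f y * conj (ψ y) = ((2 * (conj (f y) * ψ y).re : ℝ) : ℂ) := by
        rw [← Complex.add_conj]; simp
      have e3 : conj (ψ y) * Eu f y + ψ y * conj (Eu f y)
          = ((2 * (conj (ψ y) * Eu f y).re : ℝ) : ℂ) := by
        rw [← Complex.add_conj]; simp
      have e4 : conj (ψ y) * ψ y + ∑ j, conj (pdC j f y) * pdC j f y
          = ((‖ψ y‖ ^ 2 + H : ℝ) : ℂ) := by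
        simp [hH, Complex.conj_mul']
      have e5 : μ + conj μ = ((2 * μ.re : ℝ) : ℂ) := Complex.add_conj μ
      rw [e1, e2, e3, e4, e5] at hGy
      have : G y = ((Mf y ^ 2 * ((N : ℝ) / 2 * er y + (conj (ψ y) * v * f y).re
        - μ.re * er y - (‖ψ y‖ ^ 2 + H) + (conj (f y) * ψ y).re)
        - 4 * Mf y * (1 / 2 * ‖y‖ ^ 2 * er y - (conj (ψ y) * Eu f y).re) : ℝ) : ℂ) := by
        rw [hGy]; unfold Wf
        push_cast
        ring
      rw [this, Complex.ofReal_re]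
    have hE : ‖Eu f y‖ ≤ ‖y‖ * √H := by
      have c1 : ‖Eu f y‖ ≤ ∑ i, |y i| * ‖pdC i f y‖ := by
        unfold Eu
        refine (norm_sum_le _ _).trans (Finset.sum_le_sum fun i _ => ?_)
        rw [norm_mul, Complex.norm_real, Real.norm_eq_abs]
      have c2 := Finset.sum_mul_sq_le_sq_mul_sq Finset.univ (fun i => |y i|)
        (fun i => ‖pdC i f y‖)
      have c3 : ∑ i, |y i| ^ 2 = ‖y‖ ^ 2 := by
        rw [EuclideanSpace.real_norm_sq_eq]; simp
      rw [c3, ← hH] at c2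
      refine c1.trans (abs_le_of_sq_le_sq' ?_ (by positivity)).2
      rw [mul_pow, Real.sq_sqrt hH0]; exact c2
    obtain ⟨hM1, hM2⟩ := Mf_pos hy
    rw [Metric.mem_ball, dist_zero_right] at hy
    have hery : er y = ‖ψ y‖ ^ 2 + √H ^ 2 + ‖f y‖ ^ 2 := by
      rw [Real.sq_sqrt hH0, her]
    rw [hGr, hery]
    have key := real_ineq N μ.re Vm ‖ψ y‖ (√H) ‖f y‖ ‖y‖ (Mf y) (conj (ψ y) * v * f y).re
      (conj (f y) * ψ y).re (conj (ψ y) * Eu f y).re (norm_nonneg _) hy hM1 hV ?_ ?_ ?_ hm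
    · rw [Real.sq_sqrt hH0] at key ⊢; exact key
    · refine (Complex.re_le_norm _).trans ?_
      rw [norm_mul, norm_mul, RCLike.norm_conj]
      calc ‖ψ y‖ * ‖v‖ * ‖f y‖ = ‖v‖ * (‖ψ y‖ * ‖f y‖) := by ring
        _ ≤ _ := by gcongr
    · refine (Complex.re_le_norm _).trans ?_
      rw [norm_mul, RCLike.norm_conj, mul_comm]
    · refine (Complex.re_le_norm _).trans ?_
      rw [norm_mul, RCLike.norm_conj]
      gcongr
  have hcont : Continuous fun y => Mf y ^ 2 * er y := by
    have : Continuous er := by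
      rw [her]
      have h1 := hψ.diff.continuous
      have h2 := hf.diff.continuous
      have h3 : ∀ j, Continuous (pdC j f) := fun j => (hf.pdC j).diff.continuous
      fun_prop
    exact (Mf_cont.pow 2).mul this
  have hnn : ∀ y, 0 ≤ Mf y ^ 2 * er y := by
    intro y
    rw [her]; positivity
  have hinteg : MeasureTheory.Integrable fun y => Mf y ^ 2 * er y := by
    refine hcont.integrable_of_hasCompactSupport
      (HasCompactSupport.intro (isCompact_closedBall (0 : EuclideanSpace ℝ (Fin N)) 1) ?_)
    intro y hy
    rw [Mf_zero (fun h => hy (Metric.ball_subset_closedBall h))]; simp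
  have hI : ∫ y, Mf y ^ 2 * er y = 0 := by
    apply le_antisymm
    · have := MeasureTheory.integral_mono hGi.re hinteg.neg hle
      simp only [RCLike.re_to_complex, Pi.neg_apply, MeasureTheory.integral_neg] at this
      rw [hGre] at this
      linarith
    · exact MeasureTheory.integral_nonneg hnn
  have hz : (fun y => Mf y ^ 2 * er y) = 0 := by
    rw [MeasureTheory.integral_eq_zero_iff_of_nonneg hnn hinteg] at hI
    exact (hcont.ae_eq_iff_eq _ continuous_const).1 hI
  intro y hy
  have h1 := congrFun hz y
  have h2 := (Mf_pos hy).2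
  simp only [Pi.zero_apply, mul_eq_zero, pow_eq_zero_iff, ne_eq, OfNat.ofNat_ne_zero,
    not_false_eq_true, h2.ne', false_or] at h1
  rw [her] at h1
  have h3 : ‖f y‖ ^ 2 = 0 := by
    have a1 : 0 ≤ ‖ψ y‖ ^ 2 := by positivity
    have a2 : 0 ≤ ∑ j, ‖pdC j f y‖ ^ 2 := Finset.sum_nonneg fun j _ => by positivity
    have a3 : 0 ≤ ‖f y‖ ^ 2 := by positivity
    simp only at h1
    linarith
  simpa using h3

/-! ### Conclusion -/

lemma qf_eq {N : ℕ} (d y : EuclideanSpace ℝ (Fin N)) :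
    qf d y = (((1 + ⟪d, y⟫ : ℝ)) : ℂ) := by
  simp only [qf, PiLp.inner_apply, Complex.ofReal_add, Complex.ofReal_one, Complex.ofReal_sum]
  congr 1
  refine Finset.sum_congr rfl fun i _ => ?_
  simp [mul_comm]

lemma qf_ge {N : ℕ} {d y : EuclideanSpace ℝ (Fin N)}
    (hy : y ∈ Metric.ball (0 : EuclideanSpace ℝ (Fin N)) 1) : 1 - ‖d‖ ≤ 1 + ⟪d, y⟫ := by
  rw [Metric.mem_ball, dist_zero_right] at hy
  have h1 := abs_real_inner_le_norm d y
  have h2 : ‖d‖ * ‖y‖ ≤ ‖d‖ := mul_le_of_le_one_right (norm_nonneg _) hy.le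
  have h3 := neg_abs_le (⟪d, y⟫ : ℝ)
  linarith

lemma qf_pos {N : ℕ} {d y : EuclideanSpace ℝ (Fin N)} (hd : ‖d‖ < 1)
    (hy : y ∈ Metric.ball (0 : EuclideanSpace ℝ (Fin N)) 1) : 0 < 1 + ⟪d, y⟫ := by
  have := qf_ge (d := d) hy
  linarith

lemma kd_pow {N : ℕ} {p : ℝ} (hp : 1 < p) {d y : EuclideanSpace ℝ (Fin N)} (hd : ‖d‖ < 1)
    (hq : 0 < 1 + ⟪d, y⟫) :
    p * kd p d y ^ (p - 1)
      = (2 / (p - 1) + 1) * (2 / (p - 1) + 2) * (1 - ‖d‖ ^ 2) / (1 + ⟪d, y⟫) ^ 2 := by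
  have hp1 : 0 < p - 1 := by linarith
  have hd2 : 0 < 1 - ‖d‖ ^ 2 := by nlinarith [norm_nonneg d]
  have hk : 0 ≤ 2 * (p + 1) / (p - 1) ^ 2 := by
    have : 0 < p + 1 := by linarith
    positivity
  unfold kd kappa0
  rw [Real.mul_rpow (by positivity) (by positivity), Real.mul_rpow (by positivity) (by positivity),
    ← Real.rpow_mul hk, ← Real.rpow_mul hd2.le, ← Real.rpow_mul hq.le,
    show 1 / (p - 1) * (p - 1) = 1 by field_simp,
    show -(2 / (p - 1)) * (p - 1) = -(2 : ℕ) by push_cast; field_simp,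
    Real.rpow_one, Real.rpow_one, Real.rpow_neg hq.le, Real.rpow_natCast]
  field_simp
  ring

lemma exists_energy_bound {N : ℕ} {d : EuclideanSpace ℝ (Fin N)} (hd : ‖d‖ < 1) (c : ℂ) :
    ∃ K : ℝ, ∀ (μ : ℂ) (f : EuclideanSpace ℝ (Fin N) → ℂ), Sol d c μ f → K ≤ μ.re →
      ∀ y ∈ Metric.ball (0 : EuclideanSpace ℝ (Fin N)) 1, f y = 0 := by
  set Vm : ℝ := ‖c‖ / (1 - ‖d‖) ^ 2 with hVm
  have hd1 : 0 < 1 - ‖d‖ := by linarith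
  refine ⟨(N : ℝ) / 2 + 3 + (Vm + 1) / 2, fun μ f hf hK => ?_⟩
  refine energy hf.1 μ Vm (by positivity) (fun y hy => ?_) hK
  have hq := qf_pos hd hy
  have hqC : qf d y ≠ 0 := by
    rw [qf_eq]; exact Complex.ofReal_ne_zero.2 hq.ne'
  refine ⟨c / qf d y ^ 2, ?_, ?_⟩
  · rw [norm_div, norm_pow, qf_eq, Complex.norm_real, Real.norm_of_nonneg hq.le, hVm]
    have := qf_ge (d := d) hy
    gcongr
  · have := hf.2 y hy
    field_simp
    linear_combination this

lemma iterate_step {N : ℕ} {d : EuclideanSpace ℝ (Fin N)} {c : ℂ} {K : ℝ}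
    (hK : ∀ (μ : ℂ) (f : EuclideanSpace ℝ (Fin N) → ℂ), Sol d c μ f → K ≤ μ.re →
      ∀ y ∈ Metric.ball (0 : EuclideanSpace ℝ (Fin N)) 1, f y = 0) (k : ℕ) :
    ∀ (μ : ℂ) (f : EuclideanSpace ℝ (Fin N) → ℂ), Sol d c μ f →
      (∃ y ∈ Metric.ball (0 : EuclideanSpace ℝ (Fin N)) 1, f y ≠ 0) → K ≤ μ.re + k →
      ∃ j : ℕ, (μ + j) * (μ + j + 1) * (1 - ∑ i, (d i : ℂ) ^ 2) = c := by
  induction k with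
  | zero =>
    rintro μ f hf ⟨y, hy, hne⟩ hk
    exact absurd (hK μ f hf (by simpa using hk) y hy) hne
  | succ k ih =>
    rintro μ f hf ⟨y, hy, hne⟩ hk
    by_cases hX : ∀ i, ∀ y ∈ Metric.ball (0 : EuclideanSpace ℝ (Fin N)) 1, Xd d μ i f y = 0
    · exact ⟨0, by simpa using hf.final hX hy hne⟩
    · push Not at hX
      obtain ⟨i, z, hz, hzn⟩ := hX
      obtain ⟨j, hj⟩ := ih (μ + 1) (Xd d μ i f) (hf.step i) ⟨z, hz, hzn⟩ (by
        push_cast at hk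
        simp only [Complex.add_re, Complex.one_re]; linarith)
      refine ⟨j + 1, ?_⟩
      rw [← hj]; push_cast; ring

lemma exists_cutoff {N : ℕ} {φ : EuclideanSpace ℝ (Fin N) → ℂ}
    {Ω : Set (EuclideanSpace ℝ (Fin N))} (hΩ : IsOpen Ω)
    (hsub : Metric.closedBall 0 1 ⊆ Ω) (hφ : ContDiffOn ℝ (⊤ : ℕ∞) φ Ω) :
    ∃ (g : EuclideanSpace ℝ (Fin N) → ℂ) (s : Set (EuclideanSpace ℝ (Fin N))),
      Smo g ∧ IsOpen s ∧ Metric.closedBall 0 1 ⊆ s ∧ ∀ y ∈ s, g y = φ y := by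
  obtain ⟨δ, hδ, hδs⟩ := (isCompact_closedBall (0 : EuclideanSpace ℝ (Fin N)) 1).exists_cthickening_subset_open hΩ hsub
  rw [cthickening_closedBall hδ.le zero_le_one] at hδs
  let b : ContDiffBump (0 : EuclideanSpace ℝ (Fin N)) :=
    ⟨1 + δ / 2, δ + 1, by positivity, by linarith⟩
  refine ⟨fun y => (b y : ℂ) * φ y, Metric.ball 0 (1 + δ / 2), ?_, Metric.isOpen_ball,
    Metric.closedBall_subset_ball (by linarith), ?_⟩
  · unfold Smo
    rw [contDiff_iff_contDiffAt]
    intro y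
    by_cases hy : y ∈ Ω
    · have h1 : ContDiffAt ℝ (⊤ : ℕ∞) (fun y => (b y : ℂ)) y :=
        Complex.ofRealCLM.contDiff.contDiffAt.comp y b.contDiff.contDiffAt
      exact h1.mul (hφ.contDiffAt (hΩ.mem_nhds hy))
    · have hy2 : y ∈ (Metric.closedBall (0 : EuclideanSpace ℝ (Fin N)) (δ + 1))ᶜ :=
        fun h => hy (hδs h)
      have : (fun y => (b y : ℂ) * φ y) =ᶠ[nhds y] fun _ => 0 := by
        filter_upwards [Metric.isClosed_closedBall.isOpen_compl.mem_nhds hy2] with z hz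
        have : b z = 0 := by
          apply b.zero_of_le_dist
          have : ¬ dist z 0 ≤ δ + 1 := hz
          exact (not_le.1 this).le
        simp [this]
      exact contDiffAt_const.congr_of_eventuallyEq this
  · intro y hy
    have : b y = 1 := b.one_of_mem_closedBall (Metric.ball_subset_closedBall hy)
    simp [this]

/-- Mode stability of the boosted profile `κ_d`: every eigenvalue `λ` of the linearized
operator around `κ_d` with `Re λ > −1` equals `0` or `1`. -/
theorem mode_stability_kappa_d (N : ℕ) (hN : 1 ≤ N) (p : ℝ) (hp : 1 < p)
    (d : EuclideanSpace ℝ (Fin N)) (hd : ‖d‖ < 1) (lam : ℂ)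
    (hev : IsEigenvalue N p d lam) (hre : -1 < lam.re) :
    lam = 0 ∨ lam = 1 := by
  obtain ⟨φ, Ω, hΩ, hsub, hφ, heq, y0, hy0, hy0n⟩ := hev
  obtain ⟨g, s, hg, hs, hsB, hgs⟩ := exists_cutoff hΩ hsub hφ
  set α : ℝ := 2 / (p - 1) with hα
  have hp1 : 0 < p - 1 := by linarith
  have hα0 : 0 < α := by positivity
  set c : ℂ := (((α + 1) * (α + 2) * (1 - ‖d‖ ^ 2) : ℝ) : ℂ) with hc
  have hd2 : 0 < 1 - ‖d‖ ^ 2 := by nlinarith [norm_nonneg d]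
  have hsol : Sol d c (lam + α) g := by
    refine ⟨hg, fun y hy => ?_⟩
    have hyc := Metric.ball_subset_closedBall hy
    have hys := hsB hyc
    have hq := qf_pos hd hy
    have h := heq y hyc
    unfold EigenEqAt at h
    have h1 : ∀ j, ∀ y ∈ s, pdC j g y = pdC j φ y := fun j y hy => pdC_congr hs hgs j hy
    have h2 : ∀ i j, ∀ y ∈ s, pdC i (pdC j g) y = pdC i (pdC j φ) y :=
      fun i j y hy => pdC_congr hs (h1 j) i hy
    simp only [← h1 _ y hys, ← h2 _ _ y hys, ← hgs y hys] at h
    rw [hess_eq hg, show ∑ i, (y i : ℂ) * pdC i g y = Eu g y from rfl,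
      kd_pow hp hd hq, ← hα] at h
    have e1 : (p + 3) / (p - 1) = 1 + 2 * α := by rw [hα]; field_simp; ring
    have e2 : 2 * (p + 1) / (p - 1) ^ 2 = α * (1 + α) := by rw [hα]; field_simp; ring
    have e3 : 2 * (p + 1) / (p - 1) = 2 * (1 + α) := by rw [hα]; field_simp; ring
    rw [e1, e2, e3] at h
    have hqC : (((1 + ⟪d, y⟫ : ℝ)) : ℂ) ≠ 0 := Complex.ofReal_ne_zero.2 hq.ne'
    have e4 : (((α + 1) * (α + 2) * (1 - ‖d‖ ^ 2) / (1 + ⟪d, y⟫) ^ 2 : ℝ) : ℂ)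
        * (((1 + ⟪d, y⟫ : ℝ)) : ℂ) ^ 2 = c := by
      rw [hc, Complex.ofReal_div, Complex.ofReal_pow, div_mul_cancel₀ _ (pow_ne_zero 2 hqC)]
    rw [qf_eq]
    unfold Pm
    rw [← e4]
    generalize (((α + 1) * (α + 2) * (1 - ‖d‖ ^ 2) / (1 + ⟪d, y⟫) ^ 2 : ℝ) : ℂ) = v at h ⊢
    generalize (((1 + ⟪d, y⟫ : ℝ)) : ℂ) = q
    push_cast at h
    linear_combination q ^ 2 * h
  have hne : ∃ y ∈ Metric.ball (0 : EuclideanSpace ℝ (Fin N)) 1, g y ≠ 0 := by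
    by_contra hcon
    push Not at hcon
    apply hy0n
    rw [← hgs y0 (hsB hy0)]
    have hcl : IsClosed {y | g y = 0} := isClosed_eq hg.diff.continuous continuous_const
    have : closure (Metric.ball (0 : EuclideanSpace ℝ (Fin N)) 1) ⊆ {y | g y = 0} :=
      closure_minimal hcon hcl
    rw [closure_ball _ one_ne_zero] at this
    exact this hy0
  obtain ⟨K, hK⟩ := exists_energy_bound (N := N) hd c
  obtain ⟨k, hk⟩ := exists_nat_ge (K - (lam + α).re)
  obtain ⟨j, hj⟩ := iterate_step hK k (lam + α) g hsol hne (by linarith)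
  have hsum : ∑ i, (d i : ℂ) ^ 2 = ((‖d‖ ^ 2 : ℝ) : ℂ) := by
    rw [EuclideanSpace.real_norm_sq_eq]; push_cast; rfl
  have hdC : (((1 - ‖d‖ ^ 2 : ℝ)) : ℂ) ≠ 0 := Complex.ofReal_ne_zero.2 hd2.ne'
  rw [hsum, hc] at hj
  have hfac : (lam + j - 1) * (lam + j + 2 * α + 2) = 0 := by
    apply mul_right_cancel₀ hdC
    push_cast at hj ⊢
    linear_combination hj
  rcases mul_eq_zero.1 hfac with h | h
  · have hl : lam = 1 - j := by linear_combination h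
    have hr : lam.re = 1 - j := by rw [hl]; simp
    have hj2 : (j : ℝ) < 2 := by linarith
    have hj3 : j < 2 := by exact_mod_cast hj2
    interval_cases j
    · right; simpa using hl
    · left; simpa using hl
  · exfalso
    have hr := congrArg Complex.re h
    simp at hr
    have : (0 : ℝ) ≤ j := Nat.cast_nonneg j
    linarith

end
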